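/- arXiv:1405.3609 — 3 statements merged into one kernel-verified Lean document; each statement's English description precedes it below -/
import Mathlib

section
/- (First comparison lemma.) Let (σ_k)_{k≥1} be a sequence in (0,∞) and let y, ỹ be finite subsets of [0,∞); assume all the values σ_k are distinct from each other and from the points of y ∪ ỹ, so the recursion is well defined (no ties). Let (Y_k)_{k≥0} and (Ỹ_k)_{k≥0} be the solutions of the recursion with Y_0 = y and Ỹ_0 = ỹ. If y ⊆ ỹ, then Y_k ⊆ Ỹ_k for all k ≥ 0. -/
open Set

noncomputable section

/-- One step of the chain on `[0,∞)`: with `N = min (Y ∪ {∞})`, add `u`, and if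
`N < u` also remove `N`. (If `Y = ∅` then `N = ∞`, so `u` is simply added.) -/
def Ystep (A : Finset ℝ) (u : ℝ) : Finset ℝ :=
  if h : A.Nonempty then
    if u < A.min' h then insert u A else (insert u A).erase (A.min' h)
  else insert u A

/-- The chain `Y_k` started from the finite set `y`, driven by the sequence `σ`. -/
def Ychain (y : Finset ℝ) (σ : ℕ → ℝ) : ℕ → Finset ℝ
  | 0 => y
  | k + 1 => Ystep (Ychain y σ k) (σ k)

theorem mem_Ystep_iff {A : Finset ℝ} {u : ℝ} (hu : u ∉ A) (x : ℝ) :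
    x ∈ Ystep A u ↔ x = u ∨ x ∈ A ∧ (x < u → ∃ z ∈ A, z < x) := by
  unfold Ystep
  split_ifs with hA hlt
  · rw [Finset.mem_insert]
    refine or_congr_right (iff_self_and.2 fun hx hxu => ?_)
    exact absurd (hlt.trans_le (A.min'_le x hx)) hxu.not_gt
  · have hmem := A.min'_mem hA
    have hlt' : A.min' hA < u :=
      lt_of_le_of_ne (not_lt.1 hlt) fun h => hu (h ▸ hmem)
    rw [Finset.mem_erase, Finset.mem_insert]
    constructor
    · rintro ⟨hne, rfl | hx⟩
      · exact Or.inl rfl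
      · exact Or.inr ⟨hx, fun _ => ⟨_, hmem, lt_of_le_of_ne (A.min'_le x hx) hne.symm⟩⟩
    · rintro (rfl | ⟨hx, h⟩)
      · exact ⟨hlt'.ne', Or.inl rfl⟩
      · refine ⟨fun hxm => ?_, Or.inr hx⟩
        obtain ⟨z, hz, hzx⟩ := h (hxm ▸ hlt')
        exact (A.min'_le z hz).not_gt (hxm ▸ hzx)
  · rw [Finset.not_nonempty_iff_eq_empty] at hA
    simp [hA]

theorem Ystep_subset_insert (A : Finset ℝ) (u : ℝ) : Ystep A u ⊆ insert u A := by
  unfold Ystep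
  split_ifs
  · exact subset_rfl
  · exact Finset.erase_subset _ _
  · exact subset_rfl

theorem Ystep_subset_Ystep {A B : Finset ℝ} {u : ℝ} (hAB : A ⊆ B) (hu : u ∉ B) :
    Ystep A u ⊆ Ystep B u := by
  intro x hx
  rw [mem_Ystep_iff (fun h => hu (hAB h))] at hx
  rw [mem_Ystep_iff hu]
  refine hx.imp_right fun ⟨hxA, h⟩ => ⟨hAB hxA, fun hxu => ?_⟩
  obtain ⟨z, hz, hzx⟩ := h hxu
  exact ⟨z, hAB hz, hzx⟩

theorem mem_or_eq_of_mem_Ychain {y : Finset ℝ} {σ : ℕ → ℝ} {x : ℝ} :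
    ∀ {k : ℕ}, x ∈ Ychain y σ k → x ∈ y ∨ ∃ j < k, x = σ j
  | 0, hx => Or.inl hx
  | k + 1, hx => by
    rcases Finset.mem_insert.1 (Ystep_subset_insert _ _ hx) with rfl | hx
    · exact Or.inr ⟨k, k.lt_succ_self, rfl⟩
    · exact (mem_or_eq_of_mem_Ychain hx).imp_right
        fun ⟨j, hj, hxj⟩ => ⟨j, hj.trans k.lt_succ_self, hxj⟩

theorem notMem_Ychain {y : Finset ℝ} {σ : ℕ → ℝ} (hσ : Function.Injective σ)
    (hy : ∀ a ∈ y, ∀ k, σ k ≠ a) (k : ℕ) : σ k ∉ Ychain y σ k := by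
  intro h
  rcases mem_or_eq_of_mem_Ychain h with h | ⟨j, hj, h⟩
  · exact hy _ h k rfl
  · exact hj.ne (hσ h).symm

/-- **First comparison lemma.** Let `(σ_k)` be a sequence in `(0,∞)` with all values
distinct from each other and from the points of `y ∪ ỹ` (no ties), and let `y ⊆ ỹ` be
finite subsets of `[0,∞)`. Then the chains started from `y` and `ỹ` satisfy
`Y_k ⊆ Ỹ_k` for all `k ≥ 0`. -/
theorem first_comparison
    (σ : ℕ → ℝ) (hσpos : ∀ k, 0 < σ k) (hσinj : Function.Injective σ)
    (y ty : Finset ℝ)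
    (hy0 : (y : Set ℝ) ⊆ Set.Ici (0:ℝ)) (hty0 : (ty : Set ℝ) ⊆ Set.Ici (0:ℝ))
    (hties : ∀ a ∈ y ∪ ty, ∀ k, σ k ≠ a)
    (hsub : y ⊆ ty) :
    ∀ k : ℕ, Ychain y σ k ⊆ Ychain ty σ k := by
  intro k
  induction k with
  | zero => exact hsub
  | succ k ih =>
    exact Ystep_subset_Ystep ih
      (notMem_Ychain hσinj (fun a ha => hties a (Finset.mem_union_right y ha)) k)

end
end

section
/- (Stationary increments.) Let (F(k))_{k∈ℤ} be a stationary real-valued process with E[|F(1) − F(0)|] < ∞. Then E[F(1) − F(0)] = 0. -/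
open MeasureTheory ProbabilityTheory

noncomputable section

/-- If two identically distributed real random variables have an integrable difference, then the
difference has mean zero, even when neither variable is itself integrable. -/
theorem integral_sub_eq_zero_of_identDistrib
    {Ω : Type*} [MeasurableSpace Ω] {P : Measure Ω} [IsFiniteMeasure P] {X Y : Ω → ℝ}
    (hXY : IdentDistrib X Y P P) (hint : Integrable (fun ω => X ω - Y ω) P) :
    ∫ ω, (X ω - Y ω) ∂P = 0 := by
  let T : ℕ → ℝ → ℝ := fun n x => max (min x n) (-n)
  have hT : ∀ n, Measurable (T n) := fun n => by fun_prop
  have hT_bound : ∀ n x, |T n x| ≤ n := fun n x =>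
    abs_le.2 ⟨le_max_right _ _, max_le (min_le_right _ _) (by simp)⟩
  have hT_lip : ∀ n x y, |T n x - T n y| ≤ |x - y| := fun n x y =>
    (abs_max_sub_max_le_abs _ _ _).trans (abs_inf_sub_inf_le_abs _ _ _)
  have hT_lim : ∀ x, Filter.Tendsto (fun n => T n x) Filter.atTop (nhds x) := fun x => by
    refine tendsto_const_nhds.congr' ?_
    filter_upwards [Filter.eventually_ge_atTop ⌈|x|⌉₊] with n hn
    have hx := abs_le.1 (Nat.ceil_le.1 hn)
    simp only [T]
    rw [min_eq_left hx.2, max_eq_left hx.1]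
  have hT_int : ∀ n {Z : Ω → ℝ}, AEMeasurable Z P → Integrable (fun ω => T n (Z ω)) P :=
    fun n Z hZ => Integrable.of_bound ((hT n).comp_aemeasurable hZ).aestronglyMeasurable n
      (.of_forall fun ω => hT_bound n (Z ω))
  have hzero : ∀ n, ∫ ω, (T n (X ω) - T n (Y ω)) ∂P = 0 := fun n => by
    rw [integral_sub (hT_int n hXY.aemeasurable_fst) (hT_int n hXY.aemeasurable_snd), sub_eq_zero]
    exact (hXY.comp (hT n)).integral_eq
  have hlim : Filter.Tendsto (fun n => ∫ ω, (T n (X ω) - T n (Y ω)) ∂P) Filter.atTop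
      (nhds (∫ ω, (X ω - Y ω) ∂P)) :=
    tendsto_integral_of_dominated_convergence (fun ω => |X ω - Y ω|)
      (fun n => ((hT_int n hXY.aemeasurable_fst).sub
        (hT_int n hXY.aemeasurable_snd)).aestronglyMeasurable)
      hint.abs (fun n => .of_forall fun ω => hT_lip n (X ω) (Y ω))
      (.of_forall fun ω => (hT_lim (X ω)).sub (hT_lim (Y ω)))
  simp only [hzero] at hlim
  exact tendsto_nhds_unique hlim tendsto_const_nhds

/-- **Stationary increments.** If `(F(k))_{k∈ℤ}` is a stationary real-valued process
(every shift of the process has the same law as the process itself) with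
`E[|F(1) − F(0)|] < ∞`, then `E[F(1) − F(0)] = 0`. -/
theorem stationary_increments
    {Ω : Type*} [MeasurableSpace Ω] (P : Measure Ω) [IsProbabilityMeasure P]
    (F : ℤ → Ω → ℝ)
    (hmeas : ∀ k, Measurable (F k))
    (hstat : ∀ n : ℤ,
      Measure.map (fun ω => (fun k : ℤ => F (k + n) ω)) P
        = Measure.map (fun ω => (fun k : ℤ => F k ω)) P)
    (hint : Integrable (fun ω => |F 1 ω - F 0 ω|) P) :
    ∫ ω, (F 1 ω - F 0 ω) ∂P = 0 := by
  have hdist : IdentDistrib (F 1) (F 0) P P := by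
    have hproc : IdentDistrib (fun ω => (fun k : ℤ => F (k + 1) ω))
        (fun ω => (fun k : ℤ => F k ω)) P P :=
      ⟨(measurable_pi_lambda _ fun k => hmeas (k + 1)).aemeasurable,
        (measurable_pi_lambda _ hmeas).aemeasurable, hstat 1⟩
    exact hproc.comp (measurable_pi_apply (0 : ℤ))
  refine integral_sub_eq_zero_of_identDistrib hdist ?_
  exact (integrable_norm_iff ((hmeas 1).sub (hmeas 0)).aestronglyMeasurable).1 hint

end
end

section
/- (Ergodicity of a Markov chain with an atom.) Let P be a measurable probability kernel on a Polish space E (with its Borel σ-algebra), and for each x ∈ E let (X^x_k)_{k≥0} denote the Markov chain with initial state x and transition kernel P. Fix z ∈ E and set τ^x := inf{k > 0 : X^x_k = z}. Assume E[τ^z] < ∞, P[τ^x < ∞] = 1 for all x ∈ E, and that the greatest common divisor of the set {k > 0 : P[τ^z = k] > 0} is 1. Then there exists a unique P-invariant probability measure ν on E, and for every x ∈ E the total variation distance between ν and the law of X^x_k tends to 0 as k → ∞. -/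
open MeasureTheory ProbabilityTheory Filter
open scoped ENNReal

noncomputable section

/-- Total variation distance between two measures. -/
def tvDist {α : Type*} [MeasurableSpace α] (μ ν : Measure α) : ℝ≥0∞ :=
  ⨆ (A : Set α) (_ : MeasurableSet A), max (μ A - ν A) (ν A - μ A)

/-- `τ := inf {k > 0 : X_k = z}`, with value `⊤` if no such `k` exists. -/
def hitTimeZ {E Ω : Type*} (X : ℕ → Ω → E) (z : E) (ω : Ω) : ℕ∞ :=
  ⨅ (k : ℕ) (_ : 0 < k ∧ X k ω = z), (k : ℕ∞)

open scoped Topology in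
/-- A bounded solution of the limiting renewal equation which is maximal at `0` is eventually
equal to its maximum, so that the value of the maximum is determined. -/
theorem mul_tsum_eq_of_isMax_of_renewal {r w : ℕ → ℝ} {B c : ℝ} (hr0 : r 0 = 1) (hanti : Antitone r)
    (hsum : Summable r)
    (hgcd : ∀ d : ℕ, (∀ i, r i ≠ r (i + 1) → d ∣ i + 1) → d = 1)
    (hB : ∀ k, |w k| ≤ B) (hw : ∀ k, ∑' i, r i * w (k + i) = c) (hmax : ∀ k, w k ≤ w 0) :
    w 0 * ∑' i, r i = c := by
  have hlim : Tendsto r atTop (𝓝 0) := hsum.tendsto_atTop_zero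
  have hnn : ∀ i, 0 ≤ r i := fun i => hanti.le_of_tendsto hlim i
  have hsum' : Summable fun i => r (i + 1) := (summable_nat_add_iff 1).2 hsum
  have hsw : ∀ k, Summable fun i => r i * w (k + i) := fun k =>
    Summable.of_norm_bounded (hsum.mul_right B) fun i => by
      rw [Real.norm_eq_abs, abs_mul, abs_of_nonneg (hnn i)]
      exact mul_le_mul_of_nonneg_left (hB _) (hnn i)
  have hsw' : ∀ k, Summable fun i => r (i + 1) * w (k + i) := fun k =>
    Summable.of_norm_bounded (hsum'.mul_right B) fun i => by
      rw [Real.norm_eq_abs, abs_mul, abs_of_nonneg (hnn _)]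
      exact mul_le_mul_of_nonneg_left (hB _) (hnn _)
  have hgs : Summable fun i => r i - r (i + 1) := hsum.sub hsum'
  have hg1 : ∑' i, (r i - r (i + 1)) = 1 := by
    rw [hsum.tsum_sub hsum', hsum.tsum_eq_zero_add, hr0]; ring
  have hgsw : ∀ k, Summable fun i => (r i - r (i + 1)) * w (k + i) := fun k => by
    simpa only [sub_mul] using (hsw k).sub (hsw' k)
  have hrec : ∀ k, w k = ∑' i, (r i - r (i + 1)) * w (k + 1 + i) := fun k => by
    have h1 := hw k
    rw [(hsw k).tsum_eq_zero_add, hr0] at h1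
    have h2 : ∀ i, r (i + 1) * w (k + (i + 1)) = r (i + 1) * w (k + 1 + i) := fun i => by
      rw [add_assoc, add_comm i 1]
    simp only [h2, add_zero, one_mul] at h1
    simp only [sub_mul]
    rw [(hsw (k + 1)).tsum_sub (hsw' (k + 1)), hw]
    linarith
  have hprop : ∀ k, w k = w 0 → ∀ i, r i ≠ r (i + 1) → w (k + (i + 1)) = w 0 := by
    intro k hk i hi
    have hz : ∑' j, (r j - r (j + 1)) * (w 0 - w (k + 1 + j)) = 0 := by
      simp only [mul_sub]
      rw [(hgs.mul_right (w 0)).tsum_sub (hgsw (k + 1)), tsum_mul_right, hg1, ← hrec, hk]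
      ring
    have hs : Summable fun j => (r j - r (j + 1)) * (w 0 - w (k + 1 + j)) := by
      simpa only [mul_sub] using (hgs.mul_right (w 0)).sub (hgsw (k + 1))
    have h0 := (hs.hasSum_iff.2 hz)
    rw [hasSum_zero_iff_of_nonneg fun j => mul_nonneg
      (sub_nonneg.2 (hanti (Nat.le_succ j))) (sub_nonneg.2 (hmax _))] at h0
    have h1 := congrFun h0 i
    simp only [Pi.zero_apply, mul_eq_zero, sub_eq_zero, hi, false_or] at h1
    rw [h1]; congr 1; ring
  obtain ⟨n, hn⟩ := Nat.exists_mem_closure_of_ge {m : ℕ | ∃ i, m = i + 1 ∧ r i ≠ r (i + 1)}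
  have hset : Nat.setGcd {m : ℕ | ∃ i, m = i + 1 ∧ r i ≠ r (i + 1)} = 1 :=
    hgcd _ fun i hi => Nat.setGcd_dvd_of_mem ⟨i, rfl, hi⟩
  have hcl : ∀ m ∈ AddSubmonoid.closure {m : ℕ | ∃ i, m = i + 1 ∧ r i ≠ r (i + 1)},
      ∀ k, w k = w 0 → w (k + m) = w 0 := by
    intro m hm
    induction hm using AddSubmonoid.closure_induction with
    | mem x hx => obtain ⟨i, rfl, hi⟩ := hx; exact fun k hk => hprop k hk i hi
    | zero => exact fun k hk => hk
    | add x y _ _ hx hy => intro k hk; rw [← add_assoc]; exact hy _ (hx k hk)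
  have hev : ∀ m ≥ n, w m = w 0 := fun m hm => by
    simpa using hcl m (hn m hm (by rw [hset]; exact one_dvd m)) 0 rfl
  rw [← hw n, ← tsum_mul_left]
  exact tsum_congr fun i => by rw [hev (n + i) (Nat.le_add_right n i), mul_comm]

open scoped Topology in
/-- The **discrete renewal theorem** (Erdős–Feller–Pollard) with finite mean, in terms of the tail
sequence `r` of the waiting time distribution. -/
theorem tendsto_of_renewal {r u : ℕ → ℝ} (hr0 : r 0 = 1) (hanti : Antitone r)
    (hsum : Summable r)
    (hgcd : ∀ d : ℕ, (∀ i, r i ≠ r (i + 1) → d ∣ i + 1) → d = 1)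
    (hu0 : ∀ n, 0 ≤ u n) (hu1 : ∀ n, u n ≤ 1)
    (hren : ∀ n, ∑ i ∈ Finset.range (n + 1), r i * u (n - i) = 1) :
    Tendsto u atTop (𝓝 (∑' i, r i)⁻¹) := by
  have hlim : Tendsto r atTop (𝓝 0) := hsum.tendsto_atTop_zero
  have hnn : ∀ i, 0 ≤ r i := fun i => hanti.le_of_tendsto hlim i
  have hK : IsCompact (Set.Icc (0 : ℝ) 1) := isCompact_Icc
  have hmem : ∀ n, u n ∈ Set.Icc (0 : ℝ) 1 := fun n => ⟨hu0 n, hu1 n⟩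
  -- along an ultrafilter, all shifts of `u` converge and satisfy the limiting equation
  have key : ∀ U : Ultrafilter ℕ, (U : Filter ℕ) ≤ atTop → ∃ w : ℕ → ℝ,
      (∀ k, Tendsto (fun n => u (n - k)) U (𝓝 (w k))) ∧ (∀ k, MapClusterPt (w k) atTop u) ∧
      (∀ k, |w k| ≤ 1) ∧ ∀ k, ∑' i, r i * w (k + i) = 1 := by
    intro U hU
    have h1 : ∀ k, ∃ x ∈ Set.Icc (0 : ℝ) 1, Tendsto (fun n => u (n - k)) U (𝓝 x) := fun k =>
      hK.ultrafilter_le_nhds (U.map fun n => u (n - k))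
        (le_principal_iff.2 (Eventually.of_forall (f := (U : Filter ℕ)) fun n => hmem (n - k)))
    choose w hw hwt using h1
    refine ⟨w, hwt, fun k => ?_, fun k => abs_le.2 ⟨by linarith [(hw k).1], (hw k).2⟩, fun k => ?_⟩
    · exact MapClusterPt.of_comp (tendsto_sub_atTop_nat k)
        (mapClusterPt_iff_ultrafilter.2 ⟨U, hU, hwt k⟩)
    · have h2 : Tendsto (fun n => ∑' i, if k + i ≤ n then r i * u (n - (k + i)) else 0) U
          (𝓝 (∑' i, r i * w (k + i))) := by
        refine tendsto_tsum_of_dominated_convergence hsum (fun i => ?_)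
          (Eventually.of_forall fun n i => ?_)
        · refine ((hwt (k + i)).const_mul (r i)).congr' ?_
          filter_upwards [hU (eventually_ge_atTop (k + i))] with n hn
          rw [if_pos hn]
        · split_ifs
          · rw [Real.norm_eq_abs, abs_mul, abs_of_nonneg (hnn i), abs_of_nonneg (hu0 _)]
            exact mul_le_of_le_one_right (hnn i) (hu1 _)
          · simpa using hnn i
      refine tendsto_nhds_unique h2 (tendsto_const_nhds.congr' ?_)
      filter_upwards [hU (eventually_ge_atTop k)] with n hn
      rw [tsum_eq_sum (s := Finset.range (n - k + 1)), ← hren (n - k)]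
      · refine Finset.sum_congr rfl fun i hi => ?_
        rw [Finset.mem_range] at hi
        rw [if_pos (by omega), Nat.sub_sub]
      · intro i hi
        rw [Finset.mem_range] at hi
        rw [if_neg (by omega)]
  have hCc : IsClosed {x | MapClusterPt x atTop u} := isClosed_setOfPred_clusterPt
  have hCs : {x | MapClusterPt x atTop u} ⊆ Set.Icc (0 : ℝ) 1 := fun x hx =>
    isClosed_Icc.mem_of_mapClusterPt hx (Eventually.of_forall hmem)
  have hC : IsCompact {x | MapClusterPt x atTop u} := hK.of_isClosed_subset hCc hCs
  have hne : {x | MapClusterPt x atTop u}.Nonempty := by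
    obtain ⟨x, -, hx⟩ := hK.exists_mapClusterPt (f := atTop) (u := u)
      (by simpa using ⟨0, fun n _ => hmem n⟩)
    exact ⟨x, hx⟩
  have hpos : 0 < ∑' i, r i := hsum.tsum_pos hnn 0 (by rw [hr0]; exact one_pos)
  obtain ⟨M, hM, hMg⟩ := hC.exists_isGreatest hne
  obtain ⟨m, hm, hml⟩ := hC.exists_isLeast hne
  have hMv : M = (∑' i, r i)⁻¹ := by
    obtain ⟨U, hU, hUt⟩ := mapClusterPt_iff_ultrafilter.1 hM
    obtain ⟨w, hwt, hwc, hwb, hw⟩ := key U hU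
    obtain rfl : M = w 0 := tendsto_nhds_unique hUt (by simpa using hwt 0)
    exact eq_inv_of_mul_eq_one_left <|
      mul_tsum_eq_of_isMax_of_renewal hr0 hanti hsum hgcd hwb hw fun k => hMg (hwc k)
  have hmv : m = (∑' i, r i)⁻¹ := by
    obtain ⟨U, hU, hUt⟩ := mapClusterPt_iff_ultrafilter.1 hm
    obtain ⟨w, hwt, hwc, hwb, hw⟩ := key U hU
    obtain rfl : m = w 0 := tendsto_nhds_unique hUt (by simpa using hwt 0)
    have := mul_tsum_eq_of_isMax_of_renewal (w := fun k => -w k) (B := 1) (c := -1) hr0 hanti hsum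
      hgcd (by simpa using hwb) (by simp [tsum_neg, hw]) (fun k => neg_le_neg (hml (hwc k)))
    exact eq_inv_of_mul_eq_one_left (by linarith)
  refine hK.tendsto_nhds_of_unique_mapClusterPt (Eventually.of_forall hmem) fun x _ hx => ?_
  exact le_antisymm (hMv ▸ hMg hx) (hmv ▸ hml hx)

/-- The `n`-step kernel of `η`. -/
def iterKer {E : Type*} [MeasurableSpace E] (η : Kernel E E) : ℕ → Kernel E E
  | 0 => Kernel.id
  | n + 1 => η ∘ₖ iterKer η n

section Iter

variable {E : Type*} [MeasurableSpace E]

theorem iterKer_zero_apply (η : Kernel E E) (x : E) : iterKer η 0 x = Measure.dirac x :=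
  Kernel.id_apply x

theorem iterKer_succ_apply (η : Kernel E E) (n : ℕ) (x : E) :
    iterKer η (n + 1) x = η ∘ₘ iterKer η n x :=
  Kernel.comp_apply _ _ _

instance (η : Kernel E E) [IsMarkovKernel η] (n : ℕ) : IsMarkovKernel (iterKer η n) := by
  induction n with
  | zero => rw [iterKer]; infer_instance
  | succ n ih => rw [iterKer]; infer_instance

instance (η : Kernel E E) [IsFiniteKernel η] (n : ℕ) : IsFiniteKernel (iterKer η n) := by
  induction n with
  | zero => rw [iterKer]; infer_instance
  | succ n ih => rw [iterKer]; infer_instance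

theorem iterKer_comp_of_invariant {η : Kernel E E} {μ : Measure E} (h : η ∘ₘ μ = μ) (n : ℕ) :
    iterKer η n ∘ₘ μ = μ := by
  induction n with
  | zero => exact Measure.id_comp
  | succ n ih => rw [iterKer, ← Measure.comp_assoc, ih, h]

theorem comp_finset_sum_smul {ι : Type*} (η : Kernel E E) (s : Finset ι) (c : ι → ℝ≥0∞)
    (μ : ι → Measure E) : η ∘ₘ (∑ i ∈ s, c i • μ i) = ∑ i ∈ s, c i • (η ∘ₘ μ i) := by
  classical
  induction s using Finset.induction_on with
  | empty => simp
  | insert a s ha ih => rw [Finset.sum_insert ha, Finset.sum_insert ha, Measure.comp_add, ih,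
      Measure.comp_smul]

variable [MeasurableSingletonClass E]

theorem restrict_compl_singleton_comp_apply (κ : Kernel E E) (z : E) (μ : Measure E) {A : Set E}
    (hA : MeasurableSet A) :
    (κ.restrict (measurableSet_singleton z).compl ∘ₘ μ) A = (κ ∘ₘ μ) (A \ {z}) := by
  rw [Measure.bind_apply hA (Kernel.aemeasurable _),
    Measure.bind_apply (hA.diff (measurableSet_singleton z)) (Kernel.aemeasurable _)]
  exact lintegral_congr fun x => Kernel.restrict_apply' _ _ _ hA

theorem comp_eq_restrict_comp_add (κ : Kernel E E) (z : E) (μ : Measure E) :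
    κ ∘ₘ μ = κ.restrict (measurableSet_singleton z).compl ∘ₘ μ
      + (κ ∘ₘ μ) {z} • Measure.dirac z := by
  ext A hA
  rw [Measure.add_apply, restrict_compl_singleton_comp_apply κ z μ hA, Measure.smul_apply,
    smul_eq_mul, Measure.dirac_apply' _ hA,
    ← measure_sdiff_add_inter A (measurableSet_singleton z)]
  by_cases hz : z ∈ A
  · rw [Set.inter_eq_right.2 (Set.singleton_subset_iff.2 hz)]; simp [hz]
  · rw [Set.inter_singleton_eq_empty.2 hz]; simp [hz]

/-- Decomposition of the law at time `n` at the last visit to `z`. -/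
theorem iterKer_last_exit (κ : Kernel E E) (z x : E) (n : ℕ) :
    iterKer κ n x = iterKer (κ.restrict (measurableSet_singleton z).compl) n x
      + ∑ i ∈ Finset.range n, iterKer κ (n - i) x {z} •
        iterKer (κ.restrict (measurableSet_singleton z).compl) i z := by
  induction n with
  | zero => simp [iterKer_zero_apply]
  | succ n ih =>
    rw [iterKer_succ_apply κ n x, comp_eq_restrict_comp_add κ z, ← iterKer_succ_apply κ n x,
      Finset.sum_range_succ', iterKer_zero_apply, ← add_assoc, iterKer_succ_apply _ n x]
    congr 1
    conv_lhs => rw [ih, Measure.comp_add, comp_finset_sum_smul]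
    congr 1
    refine Finset.sum_congr rfl fun i _ => ?_
    rw [iterKer_succ_apply, Nat.add_sub_add_right]

/-- Decomposition of the law at time `n` at the first visit to `z`. -/
theorem iterKer_first_entrance (κ : Kernel E E) (z x : E) (n : ℕ) :
    iterKer κ n x = iterKer (κ.restrict (measurableSet_singleton z).compl) n x
      + ∑ i ∈ Finset.range n,
        (κ ∘ₘ iterKer (κ.restrict (measurableSet_singleton z).compl) i x) {z} •
        iterKer κ (n - 1 - i) z := by
  induction n with
  | zero => simp [iterKer_zero_apply]
  | succ n ih =>
    rw [iterKer_succ_apply κ n x, ih, Measure.comp_add, comp_finset_sum_smul,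
      comp_eq_restrict_comp_add κ z, ← iterKer_succ_apply _ n x,
      Finset.sum_range_succ, Nat.add_sub_cancel, Nat.sub_self, iterKer_zero_apply, add_assoc,
      add_comm (_ • Measure.dirac z)]
    congr 2
    refine Finset.sum_congr rfl fun i hi => ?_
    rw [Finset.mem_range] at hi
    rw [← iterKer_succ_apply, show n - 1 - i + 1 = n - i by omega]

theorem comp_iterKer_restrict_singleton (κ : Kernel E E) [IsMarkovKernel κ] (z x : E) (n : ℕ) :
    ((κ ∘ₘ iterKer (κ.restrict (measurableSet_singleton z).compl) n x) {z}).toReal =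
      (iterKer (κ.restrict (measurableSet_singleton z).compl) n x).real Set.univ -
      (iterKer (κ.restrict (measurableSet_singleton z).compl) (n + 1) x).real Set.univ := by
  have h := congrArg (fun μ : Measure E => μ Set.univ) (comp_eq_restrict_comp_add κ z
    (iterKer (κ.restrict (measurableSet_singleton z).compl) n x))
  simp only [Measure.add_apply, Measure.smul_apply, measure_univ, smul_eq_mul, mul_one,
    ← iterKer_succ_apply] at h
  rw [Measure.bind_apply MeasurableSet.univ (Kernel.aemeasurable _)] at h
  simp only [measure_univ, lintegral_one] at h
  rw [measureReal_def, measureReal_def, h, ENNReal.toReal_add (measure_ne_top _ _)]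
  · ring
  · exact measure_ne_top _ _

end Iter

theorem tvDist_le_ofReal {α : Type*} [MeasurableSpace α] {μ ν : Measure α} [IsFiniteMeasure μ]
    [IsFiniteMeasure ν] {ε : ℝ} (h : ∀ A, MeasurableSet A → |μ.real A - ν.real A| ≤ ε) :
    tvDist μ ν ≤ ENNReal.ofReal ε := by
  refine iSup₂_le fun A hA => ?_
  have h1 := abs_le.1 (h A hA)
  rw [← ofReal_measureReal (μ := μ), ← ofReal_measureReal (μ := ν),
    ← ENNReal.ofReal_sub _ measureReal_nonneg, ← ENNReal.ofReal_sub _ measureReal_nonneg]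
  exact max_le (ENNReal.ofReal_le_ofReal h1.2) (ENNReal.ofReal_le_ofReal (by linarith))

open scoped Topology in
theorem tendsto_measure_of_tvDist {α : Type*} [MeasurableSpace α] {μ : Measure α}
    [IsFiniteMeasure μ] {ν : ℕ → Measure α}
    (h : Tendsto (fun k => tvDist μ (ν k)) atTop (𝓝 0)) {A : Set α} (hA : MeasurableSet A) :
    Tendsto (fun k => ν k A) atTop (𝓝 (μ A)) := by
  have hle : ∀ k, max (μ A - ν k A) (ν k A - μ A) ≤ tvDist μ (ν k) := fun k =>
    le_iSup₂ (f := fun (A : Set α) (_ : MeasurableSet A) => max (μ A - ν k A) (ν k A - μ A)) A hA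
  refine tendsto_of_tendsto_of_tendsto_of_le_of_le (g := fun k => μ A - tvDist μ (ν k))
    (h := fun k => μ A + tvDist μ (ν k)) ?_ ?_ (fun k => ?_) (fun k => ?_)
  · simpa using ENNReal.Tendsto.sub (tendsto_const_nhds (x := μ A)) h
      (Or.inl (measure_ne_top μ A))
  · simpa using (tendsto_const_nhds (x := μ A)).add h
  · exact tsub_le_iff_left.2 (tsub_le_iff_right.1 ((le_max_left _ _).trans (hle k)))
  · exact tsub_le_iff_left.1 ((le_max_right _ _).trans (hle k))

open scoped Topology in
/-- Tannery's theorem for the convolution of a summable and a convergent sequence, with the last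
term omitted. -/
theorem tendsto_tsum_convolution {r a : ℕ → ℝ} {c : ℝ} (hr : ∀ i, 0 ≤ r i) (hsum : Summable r)
    (ha0 : ∀ n, 0 ≤ a n) (ha1 : ∀ n, a n ≤ 1) (ha : Tendsto a atTop (𝓝 c)) :
    Tendsto (fun n => ∑' i, |c - if i < n then a (n - i) else 0| * r i) atTop (𝓝 0) := by
  have := tendsto_tsum_of_dominated_convergence (𝓕 := atTop)
    (f := fun n i => |c - if i < n then a (n - i) else 0| * r i) (g := fun _ => (0 : ℝ))
    (hsum.mul_left (|c| + 1)) (fun i => ?_) (Eventually.of_forall fun n i => ?_)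
  · simpa using this
  · have h1 : Tendsto (fun n => |c - a (n - i)| * r i) atTop (𝓝 (|c - c| * r i)) :=
      ((tendsto_const_nhds.sub (ha.comp (tendsto_sub_atTop_nat i))).abs).mul_const _
    rw [sub_self, abs_zero, zero_mul] at h1
    refine h1.congr' ?_
    filter_upwards [eventually_gt_atTop i] with n hn
    rw [if_pos hn]
  · rw [Real.norm_eq_abs, abs_mul, abs_abs, abs_of_nonneg (hr i)]
    refine mul_le_mul_of_nonneg_right ((abs_sub _ _).trans (add_le_add_right ?_ _)) (hr i)
    split_ifs
    · rw [abs_of_nonneg (ha0 _)]; exact ha1 _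
    · simp

section Atom

variable {E : Type*} [MeasurableSpace E] [MeasurableSingletonClass E]

theorem real_iterKer_antitone (κ : Kernel E E) [IsMarkovKernel κ] (z x : E) :
    Antitone fun n =>
      (iterKer (κ.restrict (measurableSet_singleton z).compl) n x).real Set.univ :=
  antitone_nat_of_succ_le fun n => by
    have := comp_iterKer_restrict_singleton κ z x n
    have h0 : 0 ≤ ((κ ∘ₘ iterKer (κ.restrict (measurableSet_singleton z).compl) n x) {z}).toReal :=
      ENNReal.toReal_nonneg
    linarith

theorem real_iterKer_last_exit (κ : Kernel E E) [IsMarkovKernel κ] (z x : E) (n : ℕ) (A : Set E) :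
    (iterKer κ n x).real A =
      (iterKer (κ.restrict (measurableSet_singleton z).compl) n x).real A
      + ∑ i ∈ Finset.range n, (iterKer κ (n - i) x).real {z} *
        (iterKer (κ.restrict (measurableSet_singleton z).compl) i z).real A := by
  have h := congrArg (fun μ : Measure E => (μ A).toReal) (iterKer_last_exit κ z x n)
  simp only [Measure.add_apply, Measure.finsetSum_apply, Measure.smul_apply, smul_eq_mul] at h
  rw [ENNReal.toReal_add (measure_ne_top _ _)
    (ENNReal.sum_ne_top.2 fun i _ => ENNReal.mul_ne_top (measure_ne_top _ _) (measure_ne_top _ _)),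
    ENNReal.toReal_sum
      fun i _ => ENNReal.mul_ne_top (measure_ne_top _ _) (measure_ne_top _ _)] at h
  simpa only [ENNReal.toReal_mul, measureReal_def] using h

theorem real_iterKer_first_entrance (κ : Kernel E E) [IsMarkovKernel κ] (z x : E) (n : ℕ) :
    (iterKer κ (n + 1) x).real {z} = ∑ i ∈ Finset.range (n + 1),
        ((κ ∘ₘ iterKer (κ.restrict (measurableSet_singleton z).compl) i x) {z}).toReal *
        (iterKer κ (n - i) z).real {z} := by
  have h := congrArg (fun μ : Measure E => (μ {z}).toReal) (iterKer_first_entrance κ z x (n + 1))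
  have h0 : iterKer (κ.restrict (measurableSet_singleton z).compl) (n + 1) x {z} = 0 := by
    rw [iterKer_succ_apply,
      restrict_compl_singleton_comp_apply κ z _ (measurableSet_singleton z)]
    simp
  simp only [Measure.add_apply, Measure.finsetSum_apply, Measure.smul_apply, smul_eq_mul, h0,
    zero_add, Nat.add_sub_cancel] at h
  rw [ENNReal.toReal_sum
      fun i _ => ENNReal.mul_ne_top (measure_ne_top _ _) (measure_ne_top _ _)] at h
  simpa only [ENNReal.toReal_mul, measureReal_def] using h

open scoped Topology in
theorem tendsto_iterKer_atom (κ : Kernel E E) [IsMarkovKernel κ] (z : E)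
    (hsum : ∑' i, iterKer (κ.restrict (measurableSet_singleton z).compl) i z Set.univ ≠ ⊤)
    (hfin : ∀ x, Tendsto (fun n =>
      iterKer (κ.restrict (measurableSet_singleton z).compl) n x Set.univ) atTop (𝓝 0))
    (hgcd : ∀ d : ℕ, (∀ i,
      (κ ∘ₘ iterKer (κ.restrict (measurableSet_singleton z).compl) i z) {z} ≠ 0 → d ∣ i + 1) →
        d = 1) (x : E) :
    Tendsto (fun n => (iterKer κ n x).real {z}) atTop
      (𝓝 (∑' i, (iterKer (κ.restrict (measurableSet_singleton z).compl) i z).real Set.univ)⁻¹) := by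
  have hz : Tendsto (fun n => (iterKer κ n z).real {z}) atTop
      (𝓝 (∑' i, (iterKer (κ.restrict (measurableSet_singleton z).compl) i z).real
        Set.univ)⁻¹) := by
    refine tendsto_of_renewal ?_ (real_iterKer_antitone κ z z) (ENNReal.summable_toReal hsum)
      (fun d hd => hgcd d fun i hi => hd i ?_) (fun n => measureReal_nonneg)
      (fun n => measureReal_le_one) (fun n => ?_)
    · simp [iterKer_zero_apply]
    · have := comp_iterKer_restrict_singleton κ z z i
      intro h
      rw [h, sub_self, ENNReal.toReal_eq_zero_iff] at this
      exact this.elim hi (measure_ne_top _ _)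
    · have h := real_iterKer_last_exit κ z z n Set.univ
      rw [probReal_univ] at h
      rw [h, Finset.sum_range_succ, Nat.sub_self, iterKer_zero_apply, add_comm]
      congr 1
      · simp [measureReal_def]
      · exact Finset.sum_congr rfl fun i _ => mul_comm _ _
  set c := (∑' i, (iterKer (κ.restrict (measurableSet_singleton z).compl) i z).real Set.univ)⁻¹
  rw [← tendsto_add_atTop_iff_nat 1]
  have hf : HasSum (fun i =>
      ((κ ∘ₘ iterKer (κ.restrict (measurableSet_singleton z).compl) i x) {z}).toReal) 1 := by
    rw [hasSum_iff_tendsto_nat_of_nonneg fun i => ENNReal.toReal_nonneg]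
    simp only [comp_iterKer_restrict_singleton, Finset.sum_range_sub', iterKer_zero_apply,
      probReal_univ]
    simpa [measureReal_def] using tendsto_const_nhds.sub
      ((ENNReal.tendsto_toReal ENNReal.zero_ne_top).comp (hfin x))
  have h1 := tendsto_tsum_of_dominated_convergence (𝓕 := atTop)
    (f := fun n i => if i < n + 1 then
      ((κ ∘ₘ iterKer (κ.restrict (measurableSet_singleton z).compl) i x) {z}).toReal *
        (iterKer κ (n - i) z).real {z} else 0)
    (g := fun i =>
      ((κ ∘ₘ iterKer (κ.restrict (measurableSet_singleton z).compl) i x) {z}).toReal * c)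
    hf.summable (fun i => ?_) (Eventually.of_forall fun n i => ?_)
  · rw [tsum_mul_right, hf.tsum_eq, one_mul] at h1
    refine h1.congr fun n => ?_
    rw [real_iterKer_first_entrance, tsum_eq_sum (s := Finset.range (n + 1))]
    · exact Finset.sum_congr rfl fun i hi => if_pos (Finset.mem_range.1 hi)
    · exact fun i hi => if_neg (by simpa using hi)
  · refine ((hz.comp (tendsto_sub_atTop_nat i)).const_mul _).congr' ?_
    filter_upwards [eventually_ge_atTop i] with n hn
    rw [if_pos (by omega), Function.comp]
  · split_ifs
    · rw [Real.norm_eq_abs, abs_mul, abs_of_nonneg ENNReal.toReal_nonneg,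
        abs_of_nonneg measureReal_nonneg]
      exact mul_le_of_le_one_right ENNReal.toReal_nonneg measureReal_le_one
    · simp

/-- The occupation measure of an excursion from `z` is invariant. -/
theorem comp_sum_iterKer_restrict (κ : Kernel E E) [IsMarkovKernel κ] (z : E)
    (hsum : ∑' i, iterKer (κ.restrict (measurableSet_singleton z).compl) i z Set.univ ≠ ⊤) :
    κ ∘ₘ Measure.sum (fun i => iterKer (κ.restrict (measurableSet_singleton z).compl) i z) =
      Measure.sum fun i => iterKer (κ.restrict (measurableSet_singleton z).compl) i z := by
  set Q := iterKer (κ.restrict (measurableSet_singleton z).compl) with hQ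
  have h1 : ∀ A, MeasurableSet A → (κ ∘ₘ Measure.sum fun i => Q i z) A =
      ∑' i, Q (i + 1) z A + (∑' i, (κ ∘ₘ Q i z) {z}) * Measure.dirac z A := fun A hA => by
    rw [Measure.bind_apply hA (Kernel.aemeasurable _), lintegral_sum_measure,
      ← ENNReal.tsum_mul_right, ← ENNReal.tsum_add]
    refine tsum_congr fun i => ?_
    rw [← Measure.bind_apply hA (Kernel.aemeasurable _)]
    conv_lhs => rw [comp_eq_restrict_comp_add κ z]
    rw [← iterKer_succ_apply]
    rfl
  have h2 : ∀ A, MeasurableSet A → (Measure.sum fun i => Q i z) A =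
      ∑' i, Q (i + 1) z A + Measure.dirac z A := fun A hA => by
    rw [Measure.sum_apply _ hA, tsum_eq_zero_add' ENNReal.summable, hQ, iterKer_zero_apply,
      add_comm]
  have hmass : (κ ∘ₘ Measure.sum fun i => Q i z) Set.univ =
      (Measure.sum fun i => Q i z) Set.univ := by
    rw [Measure.bind_apply MeasurableSet.univ (Kernel.aemeasurable _)]
    simp
  have hF : ∑' i, (κ ∘ₘ Q i z) {z} = 1 := by
    rw [h1 _ MeasurableSet.univ, h2 _ MeasurableSet.univ, measure_univ, mul_one] at hmass
    refine (ENNReal.add_right_inj (ne_top_of_le_ne_top hsum ?_)).1 hmass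
    exact ENNReal.tsum_comp_le_tsum_of_injective (add_left_injective 1)
      fun i => Q i z Set.univ
  ext A hA
  rw [h1 A hA, h2 A hA, hF, one_mul]

open scoped Topology in
/-- Ergodicity of a Markov kernel with an atom, in terms of the kernel killed at the atom. -/
theorem exists_invariant_of_atom (κ : Kernel E E) [IsMarkovKernel κ] (z : E)
    (hsum : ∑' i, iterKer (κ.restrict (measurableSet_singleton z).compl) i z Set.univ ≠ ⊤)
    (hfin : ∀ x, Tendsto (fun n =>
      iterKer (κ.restrict (measurableSet_singleton z).compl) n x Set.univ) atTop (𝓝 0))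
    (hgcd : ∀ d : ℕ, (∀ i,
      (κ ∘ₘ iterKer (κ.restrict (measurableSet_singleton z).compl) i z) {z} ≠ 0 → d ∣ i + 1) →
        d = 1) :
    ∃ ν : Measure E, IsProbabilityMeasure ν ∧ κ ∘ₘ ν = ν ∧
      (∀ ν' : Measure E, IsProbabilityMeasure ν' → κ ∘ₘ ν' = ν' → ν' = ν) ∧
      ∀ x, Tendsto (fun k => tvDist ν (iterKer κ k x)) atTop (𝓝 0) := by
  have hcx := tendsto_iterKer_atom κ z hsum hfin hgcd
  set Q := iterKer (κ.restrict (measurableSet_singleton z).compl) with hQ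
  set ν : Measure E := (∑' i, Q i z Set.univ)⁻¹ • Measure.sum fun i => Q i z with hν
  have hpos : ∑' i, Q i z Set.univ ≠ 0 := by
    rw [Ne, ENNReal.tsum_eq_zero]
    intro h
    have := h 0
    rw [hQ, iterKer_zero_apply] at this
    simp at this
  have hprob : IsProbabilityMeasure ν := ⟨by
    rw [hν, Measure.smul_apply, Measure.sum_apply _ MeasurableSet.univ, smul_eq_mul,
      ENNReal.inv_mul_cancel hpos hsum]⟩
  have hr : Summable fun i => (Q i z).real Set.univ := ENNReal.summable_toReal hsum
  have hrnn : ∀ i, 0 ≤ (Q i z).real Set.univ := fun i => measureReal_nonneg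
  set c := (∑' i, (Q i z).real Set.univ)⁻¹ with hc
  have hQA : ∀ A, Summable fun i => (Q i z).real A := fun A =>
    Summable.of_nonneg_of_le (fun i => measureReal_nonneg)
      (fun i => measureReal_mono (Set.subset_univ A)) hr
  have hνreal : ∀ A, MeasurableSet A → ν.real A = ∑' i, c * (Q i z).real A := fun A hA => by
    rw [measureReal_def, hν, Measure.smul_apply, Measure.sum_apply _ hA, smul_eq_mul,
      ENNReal.toReal_mul, ENNReal.toReal_inv, ENNReal.tsum_toReal_eq fun i => measure_ne_top _ _,
      ENNReal.tsum_toReal_eq fun i => measure_ne_top _ _, tsum_mul_left]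
    rfl
  have htv : ∀ x, Tendsto (fun k => tvDist ν (iterKer κ k x)) atTop (𝓝 0) := by
    intro x
    have h1 : Tendsto (fun n => (Q n x).real Set.univ +
        ∑' i, |c - if i < n then (iterKer κ (n - i) x).real {z} else 0| * (Q i z).real Set.univ)
        atTop (𝓝 0) := by
      simpa [measureReal_def] using ((ENNReal.tendsto_toReal ENNReal.zero_ne_top).comp
        (hfin x)).add (tendsto_tsum_convolution hrnn hr
          (fun n => measureReal_nonneg (μ := iterKer κ n x) (s := {z}))
          (fun n => measureReal_le_one) (hcx x))
    have h2 := ENNReal.tendsto_ofReal h1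
    rw [ENNReal.ofReal_zero] at h2
    refine tendsto_of_tendsto_of_tendsto_of_le_of_le tendsto_const_nhds h2 (fun _ => zero_le)
      fun n => tvDist_le_ofReal fun A hA => ?_
    have hfs : ∀ i ∉ Finset.range n, (if i < n then (iterKer κ (n - i) x).real {z} else 0) *
        (Q i z).real A = 0 := fun i hi => by
      rw [if_neg (by simpa using hi), zero_mul]
    have hlast : (iterKer κ n x).real A = (Q n x).real A +
        ∑' i, (if i < n then (iterKer κ (n - i) x).real {z} else 0) * (Q i z).real A := by
      rw [real_iterKer_last_exit κ z x n A, tsum_eq_sum hfs]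
      congr 1
      refine Finset.sum_congr rfl fun i hi => ?_
      rw [if_pos (Finset.mem_range.1 hi)]
    have hs1 : Summable fun i => (c - if i < n then (iterKer κ (n - i) x).real {z} else 0) *
        (Q i z).real A := by
      simpa only [sub_mul] using ((hQA A).mul_left c).sub (summable_of_ne_finset_zero hfs)
    have hs2 : Summable fun i => |c - if i < n then (iterKer κ (n - i) x).real {z} else 0| *
        (Q i z).real Set.univ := by
      refine Summable.of_nonneg_of_le (fun i => mul_nonneg (abs_nonneg _) (hrnn i)) (fun i => ?_)
        (hr.mul_left (|c| + 1))
      refine mul_le_mul_of_nonneg_right ((abs_sub _ _).trans (add_le_add_right ?_ _)) (hrnn i)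
      split_ifs
      · rw [abs_of_nonneg measureReal_nonneg]; exact measureReal_le_one
      · simp
    have hdiff : ν.real A - (iterKer κ n x).real A =
        (∑' i, (c - if i < n then (iterKer κ (n - i) x).real {z} else 0) * (Q i z).real A)
          - (Q n x).real A := by
      simp only [sub_mul]
      rw [((hQA A).mul_left c).tsum_sub (summable_of_ne_finset_zero hfs), hνreal A hA, hlast]
      ring
    have hle : ∀ i, ‖(c - if i < n then (iterKer κ (n - i) x).real {z} else 0) * (Q i z).real A‖ ≤
        |c - if i < n then (iterKer κ (n - i) x).real {z} else 0| * (Q i z).real Set.univ :=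
      fun i => by
        rw [norm_mul, Real.norm_eq_abs, Real.norm_eq_abs, abs_of_nonneg measureReal_nonneg]
        exact mul_le_mul_of_nonneg_left (measureReal_mono (Set.subset_univ A)) (abs_nonneg _)
    have habs := tsum_of_norm_bounded hs2.hasSum hle
    rw [hdiff]
    refine (abs_sub _ _).trans ?_
    rw [add_comm, abs_of_nonneg measureReal_nonneg]
    exact add_le_add (measureReal_mono (Set.subset_univ A)) habs
  refine ⟨ν, hprob, ?_, fun ν' hν' hinv => ?_, htv⟩
  · rw [hν, Measure.comp_smul, comp_sum_iterKer_restrict κ z hsum]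
  · ext A hA
    have h1 : Tendsto (fun n => ∫⁻ x, iterKer κ n x A ∂ν') atTop (𝓝 (∫⁻ _, ν A ∂ν')) :=
      tendsto_lintegral_of_dominated_convergence (fun _ => 1)
        (fun n => Kernel.measurable_coe _ hA) (fun n => Eventually.of_forall fun x => prob_le_one)
        (by simp) (Eventually.of_forall fun x => tendsto_measure_of_tvDist (htv x) hA)
    have h2 : ∀ n, ∫⁻ x, iterKer κ n x A ∂ν' = ν' A := fun n => by
      rw [← Measure.bind_apply hA (Kernel.aemeasurable _), iterKer_comp_of_invariant hinv]
    simp only [h2, lintegral_const, measure_univ, mul_one] at h1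
    exact tendsto_nhds_unique tendsto_const_nhds h1

end Atom

theorem lt_hitTimeZ_iff {E Ω : Type*} {X : ℕ → Ω → E} {z : E} {ω : Ω} {k : ℕ} :
    (k : ℕ∞) < hitTimeZ X z ω ↔ ∀ i, 0 < i → i ≤ k → X i ω ≠ z := by
  rw [← ENat.add_one_le_iff (ENat.natCast_ne_top k), hitTimeZ]
  simp only [le_iInf_iff]
  refine ⟨fun h i hi hik hz => ?_, fun h i hi => ?_⟩
  · have := h i ⟨hi, hz⟩
    norm_cast at this
    omega
  · norm_cast
    by_contra hc
    exact h i hi.1 (by omega) hi.2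

theorem tsum_indicator_lt_le (n : ℕ∞) :
    ∑' k : ℕ, (if (k : ℕ∞) < n then (1 : ℝ≥0∞) else 0) ≤ (n : ℝ≥0∞) := by
  induction n with
  | top => simp
  | coe n =>
    rw [tsum_eq_sum (s := Finset.range n)]
    · rw [Finset.sum_congr rfl (g := fun _ => (1 : ℝ≥0∞))]
      · simp
      · intro k hk
        rw [if_pos (by exact_mod_cast Finset.mem_range.1 hk)]
    · intro k hk
      rw [if_neg (by simpa using hk)]

section Chain

variable {E Ω : Type*} [MeasurableSpace E]

/-- The `σ`-algebra generated by `X 0, …, X k`. -/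
abbrev pastSigma (X : ℕ → Ω → E) (k : ℕ) : MeasurableSpace Ω :=
  MeasurableSpace.comap (fun ω => (fun i : Fin (k + 1) => X i ω)) inferInstance

theorem measurableSet_pastSigma_lt_hitTimeZ [MeasurableSingletonClass E] (X : ℕ → Ω → E) (z : E)
    (k : ℕ) : MeasurableSet[pastSigma X k] {ω | (k : ℕ∞) < hitTimeZ X z ω} := by
  refine ⟨⋂ i : Fin (k + 1), {f | 0 < (i : ℕ) → f i ≠ z}, ?_, ?_⟩
  · refine MeasurableSet.iInter fun i => ?_
    by_cases hi : 0 < (i : ℕ)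
    · simp only [hi, forall_true_left]
      exact ((measurable_pi_apply i : Measurable fun f : Fin (k + 1) → E => f i)
        (measurableSet_singleton z)).compl
    · simp [hi]
  · ext ω
    simp only [Set.mem_preimage, Set.mem_iInter, Set.mem_ofPred_eq, lt_hitTimeZ_iff]
    exact ⟨fun h i hi hik => h ⟨i, by omega⟩ hi, fun h i hi => h i hi (by omega)⟩

variable [MeasurableSpace Ω]

theorem pastSigma_le {X : ℕ → Ω → E} (hX : ∀ k, Measurable (X k)) (k : ℕ) :
    pastSigma X k ≤ ‹MeasurableSpace Ω› :=
  (measurable_pi_lambda _ fun i : Fin (k + 1) => hX i).comap_le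

theorem tsum_measure_lt_hitTimeZ_le [MeasurableSingletonClass E] {P : Measure Ω} {X : ℕ → Ω → E}
    (hX : ∀ k, Measurable (X k)) (z : E) :
    ∑' k : ℕ, P {ω | (k : ℕ∞) < hitTimeZ X z ω} ≤ ∫⁻ ω, (hitTimeZ X z ω : ℝ≥0∞) ∂P := by
  have hm : ∀ k : ℕ, MeasurableSet {ω | (k : ℕ∞) < hitTimeZ X z ω} := fun k =>
    pastSigma_le hX k _ (measurableSet_pastSigma_lt_hitTimeZ X z k)
  simp only [← fun k => lintegral_indicator_one (μ := P) (hm k)]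
  rw [← lintegral_tsum fun k => (measurable_one.indicator (hm k)).aemeasurable]
  refine lintegral_mono fun ω => ?_
  simpa [Set.indicator_apply] using tsum_indicator_lt_le (hitTimeZ X z ω)

/-- The Markov property of `X` with transition kernel `κ`. -/
def IsMarkovChain (κ : Kernel E E) (P : Measure Ω) (X : ℕ → Ω → E) : Prop :=
  ∀ (k : ℕ) (B : Set E), MeasurableSet B →
    (P[fun ω => Set.indicator B (fun _ => (1:ℝ)) (X (k + 1) ω) | pastSigma X k])
      =ᵐ[P] fun ω => (κ (X k ω) B).toReal

variable {κ : Kernel E E} [IsMarkovKernel κ] {P : Measure Ω} [IsProbabilityMeasure P]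
  {X : ℕ → Ω → E}

theorem map_restrict_succ (hX : ∀ k, Measurable (X k)) (hM : IsMarkovChain κ P X) {k : ℕ}
    {S : Set Ω} (hS : MeasurableSet[pastSigma X k] S) :
    (P.restrict S).map (X (k + 1)) = κ ∘ₘ (P.restrict S).map (X k) := by
  have hS' := pastSigma_le hX k _ hS
  ext B hB
  rw [Measure.bind_apply hB (Kernel.aemeasurable _), lintegral_map (Kernel.measurable_coe κ hB)
    (hX k), Measure.map_apply (hX _) hB]
  have hind : (fun ω => Set.indicator B (fun _ => (1:ℝ)) (X (k + 1) ω)) =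
      (X (k + 1) ⁻¹' B).indicator fun _ => 1 := rfl
  have hintegrable : Integrable (fun ω => Set.indicator B (fun _ => (1:ℝ)) (X (k + 1) ω)) P := by
    rw [hind]
    exact (integrable_const 1).indicator (hX _ hB)
  have h1 := setIntegral_condExp (pastSigma_le hX k) hintegrable hS
  rw [integral_congr_ae (ae_restrict_of_ae (hM k B hB)), hind,
    integral_indicator_const _ (hX _ hB), smul_eq_mul, mul_one,
    integral_toReal (f := fun ω => κ (X k ω) B)
      ((Kernel.measurable_coe κ hB).comp (hX k)).aemeasurable
      (Eventually.of_forall fun ω => measure_lt_top _ _), measureReal_def] at h1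
  refine ((ENNReal.toReal_eq_toReal_iff' ?_ (measure_ne_top _ _)).1 h1).symm
  refine ne_top_of_le_ne_top (measure_ne_top (P.restrict S) Set.univ) ?_
  rw [← lintegral_one]
  exact lintegral_mono fun ω => prob_le_one

theorem map_eq_iterKer (hX : ∀ k, Measurable (X k)) (hM : IsMarkovChain κ P X) {x : E}
    (hX0 : ∀ ω, X 0 ω = x) (k : ℕ) : P.map (X k) = iterKer κ k x := by
  induction k with
  | zero => rw [iterKer_zero_apply, show X 0 = fun _ => x from funext hX0, Measure.map_const]; simp
  | succ k ih =>
    have := map_restrict_succ hX hM (k := k) MeasurableSet.univ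
    rw [Measure.restrict_univ] at this
    rw [this, ih, iterKer_succ_apply]

variable [MeasurableSingletonClass E]

theorem map_restrict_lt_hitTimeZ (hX : ∀ k, Measurable (X k)) (hM : IsMarkovChain κ P X) {x : E}
    (hX0 : ∀ ω, X 0 ω = x) (z : E) (k : ℕ) :
    (P.restrict {ω | (k : ℕ∞) < hitTimeZ X z ω}).map (X k) =
      iterKer (κ.restrict (measurableSet_singleton z).compl) k x := by
  induction k with
  | zero =>
    have : {ω | ((0 : ℕ) : ℕ∞) < hitTimeZ X z ω} = Set.univ :=
      Set.eq_univ_of_forall fun ω => lt_hitTimeZ_iff.2 fun i hi hi' => by omega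
    rw [this, Measure.restrict_univ, iterKer_zero_apply, show X 0 = fun _ => x from funext hX0,
      Measure.map_const]
    simp
  | succ k ih =>
    ext A hA
    rw [iterKer_succ_apply, restrict_compl_singleton_comp_apply κ z _ hA, ← ih,
      ← map_restrict_succ hX hM (measurableSet_pastSigma_lt_hitTimeZ X z k),
      Measure.map_apply (hX _) hA, Measure.map_apply (hX _) (hA.diff (measurableSet_singleton z)),
      Measure.restrict_apply (hX _ hA),
      Measure.restrict_apply (hX _ (hA.diff (measurableSet_singleton z)))]
    congr 1
    ext ω
    simp only [Set.mem_inter_iff, Set.mem_preimage, Set.mem_ofPred_eq, lt_hitTimeZ_iff,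
      Set.mem_sdiff, Set.mem_singleton_iff]
    constructor
    · rintro ⟨h1, h2⟩
      exact ⟨⟨h1, h2 _ (Nat.succ_pos k) le_rfl⟩, fun i hi hik => h2 i hi (by omega)⟩
    · rintro ⟨⟨h1, h2⟩, h3⟩
      refine ⟨h1, fun i hi hik => ?_⟩
      rcases Nat.lt_or_ge k i with h | h
      · obtain rfl : i = k + 1 := by omega
        exact h2
      · exact h3 i hi h

theorem measure_lt_hitTimeZ (hX : ∀ k, Measurable (X k)) (hM : IsMarkovChain κ P X) {x : E}
    (hX0 : ∀ ω, X 0 ω = x) (z : E) (k : ℕ) : P {ω | (k : ℕ∞) < hitTimeZ X z ω} =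
      iterKer (κ.restrict (measurableSet_singleton z).compl) k x Set.univ := by
  rw [← map_restrict_lt_hitTimeZ hX hM hX0, Measure.map_apply (hX k) MeasurableSet.univ]
  simp

open scoped Topology in
theorem tendsto_measure_lt_hitTimeZ (hX : ∀ k, Measurable (X k)) (z : E)
    (hfin : ∀ᵐ ω ∂P, hitTimeZ X z ω ≠ ⊤) :
    Tendsto (fun k : ℕ => P {ω | (k : ℕ∞) < hitTimeZ X z ω}) atTop (𝓝 0) := by
  have h := tendsto_measure_iInter_atTop (μ := P)
    (s := fun k : ℕ => {ω | (k : ℕ∞) < hitTimeZ X z ω})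
    (fun k => (pastSigma_le hX k _ (measurableSet_pastSigma_lt_hitTimeZ X z k)).nullMeasurableSet)
    (fun i j hij ω (hω : (j : ℕ∞) < _) => lt_of_le_of_lt (by exact_mod_cast hij) hω)
    ⟨0, measure_ne_top _ _⟩
  rwa [measure_mono_null (fun ω hω => ?_) (ae_iff.1 hfin)] at h
  simp only [Set.mem_iInter, Set.mem_ofPred_eq, not_not] at hω ⊢
  exact ENat.eq_top_iff_forall_gt.2 fun m => hω m

theorem measure_hitTimeZ_eq_succ_le (hX : ∀ k, Measurable (X k)) (hM : IsMarkovChain κ P X) {x : E}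
    (hX0 : ∀ ω, X 0 ω = x) (z : E) (k : ℕ) : P {ω | hitTimeZ X z ω = ((k + 1 : ℕ) : ℕ∞)} ≤
      (κ ∘ₘ iterKer (κ.restrict (measurableSet_singleton z).compl) k x) {z} := by
  rw [← map_restrict_lt_hitTimeZ hX hM hX0,
    ← map_restrict_succ hX hM (measurableSet_pastSigma_lt_hitTimeZ X z k),
    Measure.map_apply (hX _) (measurableSet_singleton z),
    Measure.restrict_apply (hX _ (measurableSet_singleton z))]
  refine measure_mono fun ω (hω : _ = _) => ?_
  have h1 : (k : ℕ∞) < hitTimeZ X z ω := by rw [hω]; exact_mod_cast Nat.lt_succ_self k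
  refine ⟨?_, h1⟩
  by_contra hne
  refine lt_irrefl ((k + 1 : ℕ) : ℕ∞) ?_
  conv_rhs => rw [← hω]
  refine lt_hitTimeZ_iff.2 fun i hi hik => ?_
  rcases Nat.lt_or_ge k i with h | h
  · obtain rfl : i = k + 1 := by omega
    exact hne
  · exact lt_hitTimeZ_iff.1 h1 i hi h

end Chain

/-- **Ergodicity of a Markov chain with an atom.** Let `κ` be a Markov (probability)
kernel on a Polish space `E` and, for each `x ∈ E`, let `(X^x_k)_{k≥0}` be a Markov
chain with initial state `x` and transition kernel `κ` (the Markov property is phrased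
via conditional expectations given the past). Fix `z ∈ E` and let `τ^x` be the first
positive time the chain started at `x` is at `z`. If `E[τ^z] < ∞`, `τ^x < ∞` a.s. for
every `x`, and the set `{k > 0 : P[τ^z = k] > 0}` has greatest common divisor `1`, then
`κ` has a unique invariant probability measure `ν`, and for every `x` the law of `X^x_k`
converges to `ν` in total variation as `k → ∞`. -/
theorem markov_chain_with_atom
    {E : Type*} [MeasurableSpace E] [TopologicalSpace E] [PolishSpace E] [BorelSpace E]
    (κ : Kernel E E) [IsMarkovKernel κ]
    {Ω : Type*} [MeasurableSpace Ω] (P : Measure Ω) [IsProbabilityMeasure P]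
    (X : E → ℕ → Ω → E)
    (hXmeas : ∀ x k, Measurable (X x k))
    (hX0 : ∀ x ω, X x 0 ω = x)
    (hMarkov : ∀ (x : E) (k : ℕ) (B : Set E), MeasurableSet B →
      (P[fun ω => Set.indicator B (fun _ => (1:ℝ)) (X x (k + 1) ω) |
          MeasurableSpace.comap (fun ω => (fun i : Fin (k + 1) => X x i ω)) inferInstance])
        =ᵐ[P] fun ω => (κ (X x k ω) B).toReal)
    (z : E)
    (hτz_int : ∫⁻ ω, (hitTimeZ (X z) z ω : ℝ≥0∞) ∂P ≠ ⊤)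
    (hτ_fin : ∀ x : E, ∀ᵐ ω ∂P, hitTimeZ (X x) z ω ≠ ⊤)
    (hgcd : ∀ d : ℕ,
      (∀ k : ℕ, 0 < k → P {ω | hitTimeZ (X z) z ω = (k : ℕ∞)} ≠ 0 → d ∣ k) → d = 1) :
    ∃ ν : Measure E, IsProbabilityMeasure ν
      ∧ (∀ A : Set E, MeasurableSet A → ν A = ∫⁻ x, κ x A ∂ν)
      ∧ (∀ ν' : Measure E, IsProbabilityMeasure ν' →
          (∀ A : Set E, MeasurableSet A → ν' A = ∫⁻ x, κ x A ∂ν') → ν' = ν)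
      ∧ ∀ x : E,
          Tendsto (fun k => tvDist ν (Measure.map (X x k) P)) atTop (nhds 0) := by
  have hM : ∀ x, IsMarkovChain κ P (X x) := hMarkov
  obtain ⟨ν, hν, hinv, huniq, hconv⟩ := exists_invariant_of_atom κ z
    (by
      simp only [← measure_lt_hitTimeZ (hXmeas z) (hM z) (hX0 z) z]
      exact ne_top_of_le_ne_top hτz_int (tsum_measure_lt_hitTimeZ_le (hXmeas z) z))
    (fun x => by
      simp only [← measure_lt_hitTimeZ (hXmeas x) (hM x) (hX0 x) z]
      exact tendsto_measure_lt_hitTimeZ (hXmeas x) z (hτ_fin x))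
    (fun d hd => hgcd d fun k hk hP => by
      obtain ⟨i, rfl⟩ := Nat.exists_eq_add_of_lt hk
      rw [zero_add] at hP ⊢
      exact hd i (ne_bot_of_le_ne_bot hP
        (measure_hitTimeZ_eq_succ_le (hXmeas z) (hM z) (hX0 z) z i)))
  refine ⟨ν, hν, fun A hA => ?_, fun ν' hν' h => huniq ν' hν' ?_, fun x => ?_⟩
  · rw [← Measure.bind_apply hA (Kernel.aemeasurable _), hinv]
  · ext A hA
    rw [Measure.bind_apply hA (Kernel.aemeasurable _), ← h A hA]
  · simpa only [map_eq_iterKer (hXmeas x) (hM x) (hX0 x)] using hconv x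

end
end
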